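/- A projection p in a von Neumann algebra A is recurrent for a Markov operator T (i.e. p ≤ p_Tr^⊥) if and only if for every superharmonic element a ∈ A₊ (T(a) ≤ a) one has p T(a) p = p a p. -/

import Mathlib

open Filter Topology ContinuousLinearMap

namespace QMP

variable {H : Type*} [NormedAddCommGroup H] [InnerProductSpace ℂ H] [CompleteSpace H]

/-- `T` is a (quantum) Markov operator on the von Neumann algebra `A`:
a normal, unital, completely positive linear map leaving `A` invariant. -/
structure IsMarkov (A : VonNeumannAlgebra H) (T : (H →L[ℂ] H) → (H →L[ℂ] H)) : Prop where
  linear : IsLinearMap ℂ T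
  mapsSelf : ∀ x ∈ A, T x ∈ A
  unital : T 1 = 1
  cp : ∀ (n : ℕ) (a b : Fin n → (H →L[ℂ] H)),
    0 ≤ ∑ i : Fin n, ∑ j : Fin n, star (b i) * T (star (a i) * a j) * b j
  normal : ∀ {ι : Type} [Preorder ι] [IsDirected ι (· ≤ ·)] (f : ι → (H →L[ℂ] H))
    (y : H →L[ℂ] H), Monotone f → IsLUB (Set.range f) y →
      IsLUB (Set.range fun i => T (f i)) (T y)

/-- `y = ∑ₙ Tⁿ x` with convergence in the strong operator topology. -/
def SOTSum (T : (H →L[ℂ] H) → (H →L[ℂ] H)) (x y : H →L[ℂ] H) : Prop :=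
  ∀ η : H, Tendsto (fun N => ∑ n ∈ Finset.range N, (T^[n] x) η) atTop (𝓝 (y η))

/-- `x ∈ A₊` is `T`-summable: `∑ₙ Tⁿ x` converges strongly to an element of `A₊`. -/
def TSummable (A : VonNeumannAlgebra H) (T : (H →L[ℂ] H) → (H →L[ℂ] H))
    (x : H →L[ℂ] H) : Prop :=
  x ∈ A ∧ 0 ≤ x ∧ ∃ y, y ∈ A ∧ 0 ≤ y ∧ SOTSum T x y

/-- `y` is a potential for `T`: `y = ∑ₙ Tⁿ x` for some `x ∈ A₊`. -/
def IsPotential (A : VonNeumannAlgebra H) (T : (H →L[ℂ] H) → (H →L[ℂ] H))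
    (y : H →L[ℂ] H) : Prop :=
  y ∈ A ∧ 0 ≤ y ∧ ∃ x, x ∈ A ∧ 0 ≤ x ∧ SOTSum T x y

/-- `p` is an orthogonal projection belonging to `A`. -/
def IsProj (A : VonNeumannAlgebra H) (p : H →L[ℂ] H) : Prop :=
  p ∈ A ∧ IsSelfAdjoint p ∧ IsIdempotentElem p

/-- `p` is the support projection of the self-adjoint element `a`. -/
def IsSupport (A : VonNeumannAlgebra H) (a p : H →L[ℂ] H) : Prop :=
  IsProj A p ∧ a = p * a * p ∧ ∀ q, IsProj A q → a = q * a * q → p ≤ q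

/-- `s` is the supremum of the family of projections `q` in the projection lattice of `A`. -/
def IsProjSup (A : VonNeumannAlgebra H) {ι : Type*} (q : ι → (H →L[ℂ] H))
    (s : H →L[ℂ] H) : Prop :=
  IsProj A s ∧ (∀ i, q i ≤ s) ∧ ∀ r, IsProj A r → (∀ i, q i ≤ r) → s ≤ r

end QMP

namespace QMP

variable {H : Type*} [NormedAddCommGroup H] [InnerProductSpace ℂ H] [CompleteSpace H]

/-- `p` is a transient projection for `T`: it is dominated by the supremum of a family of
`T`-summable projections. -/
def Transient (A : VonNeumannAlgebra H) (T : (H →L[ℂ] H) → (H →L[ℂ] H))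
    (p : H →L[ℂ] H) : Prop :=
  ∃ (ι : Type) (q : ι → (H →L[ℂ] H)) (s : H →L[ℂ] H),
    (∀ i, IsProj A (q i) ∧ TSummable A T (q i)) ∧ IsProjSup A q s ∧ p ≤ s

/-- `e` is the maximal transient projection `p_Tr`: the supremum of all transient
projections of `A`. -/
def IsMaxTransient (A : VonNeumannAlgebra H) (T : (H →L[ℂ] H) → (H →L[ℂ] H))
    (e : H →L[ℂ] H) : Prop :=
  IsProj A e ∧ (∀ p, IsProj A p → Transient A T p → p ≤ e) ∧
    ∀ r, IsProj A r → (∀ p, IsProj A p → Transient A T p → p ≤ r) → e ≤ r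

end QMP

namespace QMP

variable {H : Type*} [NormedAddCommGroup H] [InnerProductSpace ℂ H] [CompleteSpace H]

/-- A normal state on the von Neumann algebra `A`: a positive unital linear functional which
is continuous along bounded monotone sequences converging in the strong operator topology. -/
structure IsNormalState (A : VonNeumannAlgebra H) (φ : (H →L[ℂ] H) → ℂ) : Prop where
  linear : IsLinearMap ℂ φ
  unital : φ 1 = 1
  pos : ∀ x : H →L[ℂ] H, 0 ≤ x → ∃ r : ℝ, 0 ≤ r ∧ φ x = r
  normal : ∀ (f : ℕ → (H →L[ℂ] H)) (y : H →L[ℂ] H), (∀ n, f n ∈ A) → Monotone f →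
    (∀ η : H, Filter.Tendsto (fun n => (f n) η) Filter.atTop (nhds (y η))) →
    Filter.Tendsto (fun n => φ (f n)) Filter.atTop (nhds (φ y))

/-- `φ` is stationary for `T`: `φ ∘ T = φ`. -/
def Stationary (T : (H →L[ℂ] H) → (H →L[ℂ] H)) (φ : (H →L[ℂ] H) → ℂ) : Prop :=
  ∀ x : H →L[ℂ] H, φ (T x) = φ x

/-- `s` is the support projection of the state `φ`: the smallest projection `p ∈ A` with
`φ x = φ (p x p)` for all `x ∈ A`. -/
def IsStateSupport (A : VonNeumannAlgebra H) (φ : (H →L[ℂ] H) → ℂ)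
    (s : H →L[ℂ] H) : Prop :=
  IsProj A s ∧ (∀ x ∈ A, φ x = φ (s * x * s)) ∧
    ∀ q, IsProj A q → (∀ x ∈ A, φ x = φ (q * x * q)) → s ≤ q

/-- `r` is the maximal positive recurrent projection `p_R`: the supremum of the supports of
all stationary normal states of `T`. -/
def IsMaxPosRecurrent (A : VonNeumannAlgebra H) (T : (H →L[ℂ] H) → (H →L[ℂ] H))
    (r : H →L[ℂ] H) : Prop :=
  IsProj A r ∧
    (∀ φ s, IsNormalState A φ → Stationary T φ → IsStateSupport A φ s → s ≤ r) ∧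
    ∀ q, IsProj A q →
      (∀ φ s, IsNormalState A φ → Stationary T φ → IsStateSupport A φ s → s ≤ q) → r ≤ q

end QMP

open QMP

namespace QMP

section Operators

open RCLike

variable {H : Type*} [NormedAddCommGroup H] [InnerProductSpace ℂ H]

lemma re_inner_mono {x y : H →L[ℂ] H} (h : x ≤ y) (η : H) :
    re (inner ℂ (x η) η) ≤ re (inner ℂ (y η) η) := by
  have := ((le_def _ _).1 h).re_inner_nonneg_left η
  rw [sub_apply, inner_sub_left, map_sub] at this
  linarith

/-- The positive cone is closed in the strong operator topology. -/
lemma nonneg_of_sot_limit {S : ℕ → (H →L[ℂ] H)} {y : H →L[ℂ] H} (h0 : ∀ᶠ n in atTop, 0 ≤ S n)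
    (hy : ∀ η, Tendsto (fun n => S n η) atTop (𝓝 (y η))) : 0 ≤ y := by
  rw [nonneg_iff_isPositive, isPositive_iff_complex]
  intro η
  have hin : Tendsto (fun n => inner ℂ (S n η) η) atTop (𝓝 (inner ℂ (y η) η)) :=
    (hy η).inner tendsto_const_nhds
  have hS : ∀ᶠ n in atTop, (re (inner ℂ (S n η) η) : ℂ) = inner ℂ (S n η) η ∧
      0 ≤ re (inner ℂ (S n η) η) :=
    h0.mono fun n hn => (isPositive_iff_complex _).1 ((nonneg_iff_isPositive _).1 hn) η
  have hre := (continuous_re.tendsto _).comp hin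
  refine ⟨tendsto_nhds_unique ((Complex.continuous_ofReal.tendsto _).comp hre) ?_,
    ge_of_tendsto hre (hS.mono fun n hn => hn.2)⟩
  exact hin.congr' (hS.mono fun n hn => hn.1.symm)

variable [CompleteSpace H]

/-- Cauchy–Schwarz for positive operators: `‖D η‖² ≤ ‖D‖ ⟨D η, η⟩`. -/
lemma norm_apply_sq_le_of_nonneg {D : H →L[ℂ] H} (hD : 0 ≤ D) (η : H) :
    ‖D η‖ ^ 2 ≤ ‖D‖ * re (inner ℂ (D η) η) := by
  have hsq : D * D ≤ ‖D‖ • D := by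
    have h := conjugate_le_conjugate_of_nonneg
      (IsSelfAdjoint.le_algebraMap_norm_self (IsSelfAdjoint.of_nonneg hD)) (CFC.sqrt_nonneg D)
    have hs := CFC.sqrt_mul_sqrt_self D hD
    have hcomm : CFC.sqrt D * D * CFC.sqrt D = D * D := by
      calc CFC.sqrt D * D * CFC.sqrt D
          = CFC.sqrt D * (CFC.sqrt D * CFC.sqrt D) * CFC.sqrt D := by rw [hs]
        _ = (CFC.sqrt D * CFC.sqrt D) * (CFC.sqrt D * CFC.sqrt D) := by simp only [mul_assoc]
        _ = D * D := by rw [hs]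
    rwa [hcomm, Algebra.algebraMap_eq_smul_one, mul_smul_comm, mul_one, smul_mul_assoc, hs] at h
  have h := ((le_def _ _).1 hsq).re_inner_nonneg_left η
  have hsymm : inner ℂ (D (D η)) η = inner ℂ (D η) (D η) :=
    ((nonneg_iff_isPositive D).1 hD).inner_left_eq_inner_right _ _
  have hsm : inner ℂ ((‖D‖ • D) η) η = (‖D‖ : ℂ) * inner ℂ (D η) η := by
    rw [smul_apply, ← Complex.coe_smul, inner_smul_left, Complex.conj_ofReal]
  have hmul : (D * D) η = D (D η) := rfl
  rw [sub_apply, inner_sub_left, hsm, hmul, hsymm, map_sub, inner_self_eq_norm_sq] at h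
  have hre : re ((‖D‖ : ℂ) * inner ℂ (D η) η) = ‖D‖ * re (inner ℂ (D η) η) :=
    re_ofReal_mul _ _
  rw [hre] at h
  linarith

/-- A bounded increasing sequence of positive operators converges strongly. -/
lemma exists_sot_limit_of_monotone {S : ℕ → (H →L[ℂ] H)} {M : H →L[ℂ] H} (hS : Monotone S)
    (h0 : ∀ n, 0 ≤ S n) (hM : ∀ n, S n ≤ M) :
    ∃ y : H →L[ℂ] H, ∀ η, Tendsto (fun n => S n η) atTop (𝓝 (y η)) := by
  have hlim : ∀ η, ∃ z, Tendsto (fun n => S n η) atTop (𝓝 z) := by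
    intro η
    apply cauchySeq_tendsto_of_complete
    have hmono : Monotone fun n => re (inner ℂ (S n η) η) := fun m n h => re_inner_mono (hS h) η
    have hbdd : BddAbove (Set.range fun n => re (inner ℂ (S n η) η)) :=
      ⟨re (inner ℂ (M η) η), by rintro _ ⟨n, rfl⟩; exact re_inner_mono (hM n) η⟩
    have hc := (tendsto_atTop_ciSup hmono hbdd).cauchySeq
    have key : ∀ m n, m ≤ n → ‖S n η - S m η‖ ^ 2 ≤
        ‖M‖ * (re (inner ℂ (S n η) η) - re (inner ℂ (S m η) η)) := by
      intro m n hmn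
      have hD : 0 ≤ S n - S m := sub_nonneg.2 (hS hmn)
      have h1 := norm_apply_sq_le_of_nonneg hD η
      have h2 : ‖S n - S m‖ ≤ ‖M‖ :=
        CStarAlgebra.norm_le_norm_of_nonneg_of_le hD ((sub_le_self _ (h0 m)).trans (hM n))
      rw [sub_apply, inner_sub_left, map_sub] at h1
      exact h1.trans (mul_le_mul_of_nonneg_right h2 (sub_nonneg.2 (hmono hmn)))
    rw [Metric.cauchySeq_iff'] at hc ⊢
    intro ε hε
    obtain ⟨N, hN⟩ := hc (ε ^ 2 / (‖M‖ + 1)) (by positivity)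
    refine ⟨N, fun n hn => ?_⟩
    have h1 := key N n hn
    have h2 := hN n hn
    rw [Real.dist_eq, abs_of_nonneg (sub_nonneg.2 (hmono hn)), lt_div_iff₀ (by positivity)] at h2
    have h3 : 0 ≤ re (inner ℂ (S n η) η) - re (inner ℂ (S N η) η) := sub_nonneg.2 (hmono hn)
    rw [dist_eq_norm]
    refine lt_of_pow_lt_pow_left₀ 2 hε.le ?_
    nlinarith
  choose f hf using hlim
  exact ⟨continuousLinearMapOfTendsto S (f := f) (tendsto_pi_nhds.2 hf), hf⟩

/-- The strong limit of an increasing sequence is its least upper bound. -/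
lemma isLUB_of_sot_limit {S : ℕ → (H →L[ℂ] H)} {y : H →L[ℂ] H} (hS : Monotone S)
    (hy : ∀ η, Tendsto (fun n => S n η) atTop (𝓝 (y η))) : IsLUB (Set.range S) y := by
  constructor
  · rintro _ ⟨m, rfl⟩
    refine sub_nonneg.1 (nonneg_of_sot_limit (S := fun n => S n - S m) ?_ fun η => ?_)
    · filter_upwards [eventually_ge_atTop m] with n hn using sub_nonneg.2 (hS hn)
    · simpa using (hy η).sub_const _
  · intro b hb
    refine sub_nonneg.1 (nonneg_of_sot_limit (S := fun n => b - S n) ?_ fun η => ?_)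
    · exact .of_forall fun n => sub_nonneg.2 (hb ⟨n, rfl⟩)
    · simpa using (hy η).const_sub _

lemma mem_of_forall_commute (A : VonNeumannAlgebra H) {x : H →L[ℂ] H}
    (h : ∀ c ∈ A.commutant, Commute c x) : x ∈ A := by
  rw [← A.commutant_commutant, VonNeumannAlgebra.mem_commutant_iff]
  exact h

lemma commute_of_mem_commutant {A : VonNeumannAlgebra H} {c x : H →L[ℂ] H}
    (hc : c ∈ A.commutant) (hx : x ∈ A) : Commute x c :=
  VonNeumannAlgebra.mem_commutant_iff.1 hc x hx

/-- Von Neumann algebras are sequentially closed in the strong operator topology. -/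
lemma mem_of_sot_limit (A : VonNeumannAlgebra H) {S : ℕ → (H →L[ℂ] H)} {y : H →L[ℂ] H}
    (hS : ∀ n, S n ∈ A) (hy : ∀ η, Tendsto (fun n => S n η) atTop (𝓝 (y η))) : y ∈ A := by
  refine mem_of_forall_commute A fun c hc => ?_
  ext η
  refine tendsto_nhds_unique ((c.continuous.tendsto _).comp (hy η)) ?_
  refine (hy (c η)).congr fun n => ?_
  exact congr($(commute_of_mem_commutant hc (hS n)) η)

lemma IsProj.isStarProjection {A : VonNeumannAlgebra H} {p : H →L[ℂ] H} (hp : IsProj A p) :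
    IsStarProjection p :=
  ⟨hp.2.2, hp.2.1⟩

lemma IsProj.one_sub {A : VonNeumannAlgebra H} {p : H →L[ℂ] H} (hp : IsProj A p) :
    IsProj A (1 - p) :=
  have h := hp.isStarProjection.one_sub
  ⟨sub_mem (one_mem A) hp.1, h.isSelfAdjoint, h.isIdempotentElem⟩

/-- A spectral projection of `x ≥ 0` at height `ε`: a projection `q ∈ A` with `ε q ≤ x` off which
`x` is at most `ε`. -/
lemma exists_spectral_proj (A : VonNeumannAlgebra H) {x : H →L[ℂ] H} (hxA : x ∈ A) (hx : 0 ≤ x)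
    (ε : ℝ) : ∃ q g, IsProj A q ∧ ε • q ≤ x ∧ q * g = g ∧ x ≤ ε • 1 + g := by
  set z : H →L[ℂ] H := x - ε • 1 with hz
  have hzs : IsSelfAdjoint z :=
    (IsSelfAdjoint.of_nonneg hx).sub (.smul (IsSelfAdjoint.all ε) (.one _))
  set g := z⁺ with hg
  set h := z⁻ with hh
  have hg0 : 0 ≤ g := CFC.posPart_nonneg z
  have hh0 : 0 ≤ h := CFC.negPart_nonneg z
  have hgh : g - h = z := CFC.posPart_sub_negPart z hzs
  have hxe : x = ε • 1 + g - h := by rw [add_sub_assoc, hgh, hz]; abel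
  have hmul : h * g = 0 := CFC.negPart_mul_posPart z
  have : CompleteSpace h.ker := h.isClosed_ker.completeSpace_coe
  set q : H →L[ℂ] H := h.ker.starProjection with hq
  have hqs : IsStarProjection q := isStarProjection_starProjection
  have hhq : h * q = 0 := by
    ext η
    exact LinearMap.mem_ker.1 (h.ker.starProjection_apply_mem η)
  have hqh : q * h = 0 := by
    simpa [hqs.isSelfAdjoint.star_eq, (IsSelfAdjoint.of_nonneg hh0).star_eq] using congr(star $hhq)
  have hqg : q * g = g := by
    ext η
    exact Submodule.starProjection_eq_self_iff.2 (LinearMap.mem_ker.2 congr($hmul η))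
  have hgq : g * q = g := by
    simpa [hqs.isSelfAdjoint.star_eq, (IsSelfAdjoint.of_nonneg hg0).star_eq] using congr(star $hqg)
  have hqA : q ∈ A := by
    rw [VonNeumannAlgebra.IsStarProjection.mem_iff hqs]
    intro c hc
    have hcz : Commute z c := by
      rw [hz]
      exact (commute_of_mem_commutant hc hxA).sub_left ((Commute.one_left c).smul_left ε)
    have hch : Commute h c := hcz.cfcₙ_real _
    rw [hq, Submodule.range_starProjection]
    intro v hv
    have hv0 : h v = 0 := hv
    have h1 : h (c v) = c (h v) := congr($hch v)
    change h (c v) = 0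
    rw [h1, hv0, map_zero]
  refine ⟨q, g, ⟨hqA, hqs.isSelfAdjoint, hqs.isIdempotentElem⟩, ?_, hqg, ?_⟩
  · have hxq : x * q = ε • q + g := by
      rw [hxe, sub_mul, add_mul, hhq, hgq, smul_mul_assoc, one_mul, sub_zero]
    have hqx : q * x = ε • q + g := by
      rw [hxe, mul_sub, mul_add, hqh, hqg, mul_smul_comm, mul_one, sub_zero]
    have hqxq : q * x * q = ε • q + g := by
      rw [hqx, add_mul, smul_mul_assoc, hqs.isIdempotentElem.eq, hgq]
    have hdec : x - ε • q = g + (1 - q) * x * (1 - q) := by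
      have : (1 - q) * x * (1 - q) = x - q * x - x * q + q * x * q := by noncomm_ring
      rw [this, hqxq, hqx, hxq]; abel
    rw [← sub_nonneg, hdec]
    exact add_nonneg hg0 (hqs.one_sub.isSelfAdjoint.conjugate_nonneg hx)
  · rw [hxe]
    exact sub_le_self _ hh0

end Operators

section Markov

variable {H : Type*} [NormedAddCommGroup H] [InnerProductSpace ℂ H] [CompleteSpace H]
  {A : VonNeumannAlgebra H} {T : (H →L[ℂ] H) → (H →L[ℂ] H)}

lemma IsMarkov.nonneg (hT : IsMarkov A T) {x : H →L[ℂ] H} (hx : 0 ≤ x) : 0 ≤ T x := by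
  have h := hT.cp 1 (fun _ => CFC.sqrt x) (fun _ => 1)
  simpa [(IsSelfAdjoint.of_nonneg (CFC.sqrt_nonneg x)).star_eq, CFC.sqrt_mul_sqrt_self x hx] using h

lemma IsMarkov.map_sub (hT : IsMarkov A T) (x y : H →L[ℂ] H) : T (x - y) = T x - T y :=
  hT.linear.map_sub x y

lemma IsMarkov.mono (hT : IsMarkov A T) : Monotone T := fun x y h => by
  rw [← sub_nonneg, ← hT.map_sub]
  exact hT.nonneg (sub_nonneg.2 h)

lemma IsMarkov.map_real_smul (hT : IsMarkov A T) (c : ℝ) (x : H →L[ℂ] H) :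
    T (c • x) = c • T x := by
  rw [← Complex.coe_smul, ← Complex.coe_smul, hT.linear.map_smul]

lemma IsMarkov.iterate_nonneg (hT : IsMarkov A T) {x : H →L[ℂ] H} (hx : 0 ≤ x) (n : ℕ) :
    0 ≤ T^[n] x :=
  Function.Iterate.rec (fun y => 0 ≤ y) hx (fun _ => hT.nonneg) n

lemma IsMarkov.iterate_mem (hT : IsMarkov A T) {x : H →L[ℂ] H} (hx : x ∈ A) (n : ℕ) :
    T^[n] x ∈ A :=
  Function.Iterate.rec (fun y => y ∈ A) hx hT.mapsSelf n

lemma IsMarkov.map_sum_iterate (hT : IsMarkov A T) (x : H →L[ℂ] H) (N : ℕ) :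
    T (∑ n ∈ Finset.range N, T^[n] x) = ∑ n ∈ Finset.range (N + 1), T^[n] x - x := by
  rw [Finset.sum_range_succ', Function.iterate_zero_apply, add_sub_cancel_right]
  simpa only [Function.iterate_succ_apply', IsLinearMap.mk'_apply] using
    map_sum (hT.linear.mk' T) (fun n => T^[n] x) (Finset.range N)

lemma IsMarkov.monotone_sum_iterate (hT : IsMarkov A T) {x : H →L[ℂ] H} (hx : 0 ≤ x) :
    Monotone fun N => ∑ n ∈ Finset.range N, T^[n] x :=
  monotone_nat_of_le_succ fun N => by
    rw [Finset.sum_range_succ]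
    exact le_add_of_nonneg_right (hT.iterate_nonneg hx N)

/-- The charge of a potential is recovered by `1 - T`. -/
lemma IsMarkov.map_eq_sub_of_sotSum (hT : IsMarkov A T) {x y : H →L[ℂ] H} (hx : 0 ≤ x)
    (h : SOTSum T x y) : T y = y - x := by
  have hS := hT.monotone_sum_iterate hx
  have hlim : ∀ η, Tendsto (fun N => (∑ n ∈ Finset.range N, T^[n] x) η) atTop (𝓝 (y η)) := by
    simpa only [SOTSum, sum_apply] using h
  refine (hT.normal _ y hS (isLUB_of_sot_limit hS hlim)).unique
    (isLUB_of_sot_limit (hT.mono.comp hS) fun η => ?_)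
  simp only [hT.map_sum_iterate, sub_apply]
  exact ((tendsto_add_atTop_iff_nat 1).2 (hlim η)).sub_const _

/-- A positive element dominated by the charge `a - T a` of a positive `a` is summable. -/
lemma IsMarkov.tsummable_of_le_sub (hT : IsMarkov A T) {a x : H →L[ℂ] H} (ha : 0 ≤ a)
    (hxA : x ∈ A) (hx : 0 ≤ x) (hxa : x ≤ a - T a) : TSummable A T x := by
  have hle : ∀ N, ∑ n ∈ Finset.range N, T^[n] x ≤ a := by
    intro N
    induction N with
    | zero => simpa using ha
    | succ N ih =>
      have h1 : ∑ n ∈ Finset.range (N + 1), T^[n] x - x ≤ T a :=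
        (hT.map_sum_iterate x N).symm.trans_le (hT.mono ih)
      have := add_le_add h1 hxa
      simpa using this
  have h0 : ∀ N, 0 ≤ ∑ n ∈ Finset.range N, T^[n] x := fun N =>
    Finset.sum_nonneg fun n _ => hT.iterate_nonneg hx n
  obtain ⟨y, hy⟩ := exists_sot_limit_of_monotone (hT.monotone_sum_iterate hx) h0 hle
  refine ⟨hxA, hx, y, ?_, nonneg_of_sot_limit (.of_forall h0) hy, ?_⟩
  · exact mem_of_sot_limit A (fun N => sum_mem fun n _ => hT.iterate_mem hxA n) hy
  · simpa only [SOTSum, sum_apply] using hy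

lemma transient_of_tsummable {q : H →L[ℂ] H} (hq : IsProj A q) (hs : TSummable A T q) :
    Transient A T q :=
  ⟨Unit, fun _ => q, q, fun _ => ⟨hq, hs⟩, ⟨hq, fun _ => le_rfl, fun _ _ h => h ()⟩, le_rfl⟩

lemma IsMaxTransient.le_of_forall_tsummable {e r : H →L[ℂ] H} (he : IsMaxTransient A T e)
    (hr : IsProj A r) (h : ∀ q, IsProj A q → TSummable A T q → q ≤ r) : e ≤ r := by
  refine he.2.2 r hr ?_
  rintro p - ⟨ι, q, s, hq, hs, hps⟩
  exact hps.trans (hs.2.2 r hr fun i => h _ (hq i).1 (hq i).2)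

/-- The charge of a superharmonic element vanishes on the complement of the maximal transient
projection. -/
lemma IsMaxTransient.corner_charge_eq_zero (hT : IsMarkov A T) {e : H →L[ℂ] H}
    (he : IsMaxTransient A T e) {a : H →L[ℂ] H} (haA : a ∈ A) (ha : 0 ≤ a) (hTa : T a ≤ a) :
    (1 - e) * (a - T a) * (1 - e) = 0 := by
  set x := a - T a with hx
  have hx0 : 0 ≤ x := sub_nonneg.2 hTa
  have hes := he.1.isStarProjection
  have hf := hes.one_sub
  have hpos : 0 ≤ (1 - e) * x * (1 - e) := hf.isSelfAdjoint.conjugate_nonneg hx0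
  have hbound : ∀ ε : ℝ, 0 < ε → ‖(1 - e) * x * (1 - e)‖ ≤ ε := by
    intro ε hε
    obtain ⟨q, g, hq, hqx, hqg, hxg⟩ :=
      exists_spectral_proj A (sub_mem haA (hT.mapsSelf a haA)) hx0 ε
    have hqs : TSummable A T q := by
      refine hT.tsummable_of_le_sub (a := ε⁻¹ • a) (smul_nonneg (by positivity) ha) hq.1
        hq.isStarProjection.nonneg ?_
      rw [hT.map_real_smul, ← smul_sub, ← inv_smul_smul₀ hε.ne' q]
      exact smul_le_smul_of_nonneg_left hqx (by positivity)
    have hqe : e * q = q := (hq.isStarProjection.le_iff_mul_eq_right hes).1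
      (he.2.1 q hq (transient_of_tsummable hq hqs))
    have hfg : (1 - e) * g = 0 := by
      rw [← hqg, ← mul_assoc, sub_mul, hqe, one_mul, sub_self, zero_mul]
    have hle : (1 - e) * x * (1 - e) ≤ ε • (1 - e) := by
      refine (hf.isSelfAdjoint.conjugate_le_conjugate hxg).trans_eq ?_
      rw [mul_add, hfg, add_zero, mul_smul_comm, mul_one, smul_mul_assoc, hf.isIdempotentElem.eq]
    refine (CStarAlgebra.norm_le_norm_of_nonneg_of_le hpos hle).trans ?_
    rw [norm_smul, Real.norm_of_nonneg hε.le]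
    exact mul_le_of_le_one_right hε.le hf.norm_le
  exact norm_le_zero_iff.1 (le_of_forall_pos_le_add fun ε hε => by simpa using hbound ε hε)

end Markov

end QMP

/-- A projection `p` is recurrent (`p ≤ p_Tr^⊥`) iff every superharmonic positive element
is fixed on `p`: `p (T a) p = p a p`. -/
theorem recurrent_iff_superharmonic_fixed_on_corner
    {H : Type*} [NormedAddCommGroup H] [InnerProductSpace ℂ H] [CompleteSpace H]
    (A : VonNeumannAlgebra H) (T : (H →L[ℂ] H) → (H →L[ℂ] H)) (hT : IsMarkov A T)
    (p : H →L[ℂ] H) (hp : IsProj A p)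
    (e : H →L[ℂ] H) (he : IsMaxTransient A T e) :
    p ≤ 1 - e ↔ ∀ a ∈ A, 0 ≤ a → T a ≤ a → p * T a * p = p * a * p := by
  have hps := hp.isStarProjection
  constructor
  · intro hpe a haA ha hTa
    have hle := hps.le_iff_mul_eq_left he.1.isStarProjection.one_sub
    have hle' := hps.le_iff_mul_eq_right he.1.isStarProjection.one_sub
    have hz : p * (a - T a) * p = 0 := by
      calc p * (a - T a) * p = (p * (1 - e)) * (a - T a) * ((1 - e) * p) := by
            rw [hle.1 hpe, hle'.1 hpe]
        _ = p * ((1 - e) * (a - T a) * (1 - e)) * p := by simp only [mul_assoc]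
        _ = 0 := by rw [he.corner_charge_eq_zero hT haA ha hTa, mul_zero, zero_mul]
    rw [mul_sub, sub_mul, sub_eq_zero] at hz
    exact hz.symm
  · intro h
    refine le_sub_comm.1 (he.le_of_forall_tsummable hp.one_sub ?_)
    intro q hq hqs
    obtain ⟨-, hq0, y, hyA, hy0, hsum⟩ := hqs
    have hTy := hT.map_eq_sub_of_sotSum hq0 hsum
    have hpq := h y hyA hy0 (hTy.trans_le (sub_le_self _ hq0))
    rw [hTy, mul_sub, sub_mul, sub_eq_self] at hpq
    have hqp : q * p = 0 := by
      rw [← CStarRing.star_mul_self_eq_zero_iff, star_mul, hps.isSelfAdjoint.star_eq,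
        hq.2.1.star_eq, ← hpq]
      rw [mul_assoc, ← mul_assoc q, hq.2.2.eq, mul_assoc]
    rw [hq.isStarProjection.le_iff_mul_eq_left hps.one_sub, mul_sub, mul_one, hqp, sub_zero]
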